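/- For every real number s, the function z_{s,s}(x) = e^{ψ(x+s)} − x is convex and decreasing on the interval (−s, ∞). -/

import Mathlib

/-- The digamma function `ψ = Γ'/Γ`, as the derivative of `log ∘ Γ`. -/
noncomputable def digamma (x : ℝ) : ℝ := deriv (fun y : ℝ => Real.log (Real.Gamma y)) x

open Filter Topology Set

/-- Approximations of the digamma function, obtained by applying `n` times the recurrence
`ψ x = ψ (x + 1) - 1 / x` and replacing the remaining `ψ y` by `log (y - 1 / 2)`. -/
noncomputable def digammaApprox : ℕ → ℝ → ℝ
  | 0, x => Real.log (x - 1 / 2)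
  | n + 1, x => digammaApprox n (x + 1) - x⁻¹

/-- The derivative of `digammaApprox n`. -/
noncomputable def digammaApproxDeriv : ℕ → ℝ → ℝ
  | 0, x => (x - 1 / 2)⁻¹
  | n + 1, x => digammaApproxDeriv n (x + 1) + (x ^ 2)⁻¹

/-- The second derivative of `digammaApprox n`. -/
noncomputable def digammaApproxDeriv2 : ℕ → ℝ → ℝ
  | 0, x => -((x - 1 / 2) ^ 2)⁻¹
  | n + 1, x => digammaApproxDeriv2 n (x + 1) - 2 * (x ^ 3)⁻¹

theorem hasDerivAt_digammaApprox (n : ℕ) {x : ℝ} (hx : 0 < x) (hxn : 1 / 2 < x + n) :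
    HasDerivAt (digammaApprox n) (digammaApproxDeriv n x) x := by
  induction n generalizing x with
  | zero =>
    simp only [Nat.cast_zero, add_zero] at hxn
    have hne : x - 1 / 2 ≠ 0 := by linarith
    exact (Real.hasDerivAt_log hne).comp_sub_const x (1 / 2)
  | succ n ih =>
    push_cast at hxn
    have h := (ih (x := x + 1) (by linarith) (by linarith)).comp_add_const x 1
    exact (h.sub (hasDerivAt_inv hx.ne')).congr_deriv (sub_neg_eq_add _ _)

theorem hasDerivAt_digammaApproxDeriv (n : ℕ) {x : ℝ} (hx : 0 < x) (hxn : 1 / 2 < x + n) :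
    HasDerivAt (digammaApproxDeriv n) (digammaApproxDeriv2 n x) x := by
  induction n generalizing x with
  | zero =>
    simp only [Nat.cast_zero, add_zero] at hxn
    have hne : x - 1 / 2 ≠ 0 := by linarith
    exact (hasDerivAt_inv hne).comp_sub_const x (1 / 2)
  | succ n ih =>
    push_cast at hxn
    have h := (ih (x := x + 1) (by linarith) (by linarith)).comp_add_const x 1
    have h2 := (hasDerivAt_pow 2 x).inv (pow_ne_zero 2 hx.ne')
    refine (h.add h2).congr_deriv ?_
    simp only [digammaApproxDeriv2]
    field_simp
    ring

theorem le_digammaApproxDeriv (n : ℕ) {x : ℝ} (hx : 0 < x) (hxn : 1 / 2 < x + n) :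
    x⁻¹ + (x ^ 2)⁻¹ / 2 ≤ digammaApproxDeriv n x := by
  induction n generalizing x with
  | zero =>
    simp only [Nat.cast_zero, add_zero] at hxn
    have hpos : 0 < x - 1 / 2 := by linarith
    have hne : x * 2 - 1 ≠ 0 := by linarith
    have key : digammaApproxDeriv 0 x - (x⁻¹ + (x ^ 2)⁻¹ / 2) = (x - 1 / 2)⁻¹ * (x ^ 2)⁻¹ / 4 := by
      simp only [digammaApproxDeriv]
      field_simp
      ring
    have : 0 ≤ (x - 1 / 2)⁻¹ * (x ^ 2)⁻¹ / 4 := by positivity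
    linarith
  | succ n ih =>
    push_cast at hxn
    have h := ih (x := x + 1) (by linarith) (by linarith)
    have key : (x + 1)⁻¹ + ((x + 1) ^ 2)⁻¹ / 2 + (x ^ 2)⁻¹ - (x⁻¹ + (x ^ 2)⁻¹ / 2)
        = (x⁻¹ - (x + 1)⁻¹) ^ 2 / 2 := by
      field_simp
      ring
    have := sq_nonneg (x⁻¹ - (x + 1)⁻¹)
    simp only [digammaApproxDeriv]
    linarith

theorem digammaApproxDeriv2_add_sq_nonneg (n : ℕ) {x : ℝ} (hx : 0 < x) (hxn : 1 / 2 < x + n) :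
    0 ≤ digammaApproxDeriv2 n x + digammaApproxDeriv n x ^ 2 := by
  induction n generalizing x with
  | zero => simp [digammaApproxDeriv2, digammaApproxDeriv]
  | succ n ih =>
    have hD := le_digammaApproxDeriv (n + 1) hx hxn
    push_cast at hxn
    have h := ih (x := x + 1) (by linarith) (by linarith)
    simp only [digammaApproxDeriv2, digammaApproxDeriv] at hD ⊢
    have hmul := mul_le_mul_of_nonneg_left hD (by positivity : 0 ≤ 2 * (x ^ 2)⁻¹)
    have key : 2 * (x ^ 2)⁻¹ * (x⁻¹ + (x ^ 2)⁻¹ / 2) = 2 * (x ^ 3)⁻¹ + (x ^ 2)⁻¹ ^ 2 := by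
      field_simp
    rw [key] at hmul
    linarith

theorem convexOn_exp_digammaApprox (n : ℕ) :
    ConvexOn ℝ (Ioi 0) (fun x => Real.exp (digammaApprox (n + 1) x)) := by
  have hn : ∀ x : ℝ, 0 < x → 1 / 2 < x + ((n + 1 : ℕ) : ℝ) := fun x hx => by
    push_cast
    linarith [n.cast_nonneg (α := ℝ)]
  have h1 : ∀ x : ℝ, 0 < x → HasDerivAt (fun x => Real.exp (digammaApprox (n + 1) x))
      (Real.exp (digammaApprox (n + 1) x) * digammaApproxDeriv (n + 1) x) x :=
    fun x hx => (hasDerivAt_digammaApprox (n + 1) hx (hn x hx)).exp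
  refine convexOn_of_hasDerivWithinAt2_nonneg (convex_Ioi 0)
    (f' := fun x => Real.exp (digammaApprox (n + 1) x) * digammaApproxDeriv (n + 1) x)
    (f'' := fun x => Real.exp (digammaApprox (n + 1) x) *
      (digammaApproxDeriv2 (n + 1) x + digammaApproxDeriv (n + 1) x ^ 2))
    (fun x hx => (h1 x hx).continuousAt.continuousWithinAt) ?_ ?_ ?_ <;>
    rw [interior_Ioi] <;> intro x hx
  · exact (h1 x hx).hasDerivWithinAt
  · refine (((h1 x hx).mul (hasDerivAt_digammaApproxDeriv (n + 1) hx
      (hn x hx))).congr_deriv ?_).hasDerivWithinAt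
    ring
  · exact mul_nonneg (Real.exp_pos _).le (digammaApproxDeriv2_add_sq_nonneg (n + 1) hx (hn x hx))

theorem differentiableAt_log_Gamma {x : ℝ} (hx : 0 < x) :
    DifferentiableAt ℝ (Real.log ∘ Real.Gamma) x := by
  refine (Real.differentiableAt_log (Real.Gamma_pos_of_pos hx).ne').comp x
    (Real.differentiableAt_Gamma fun m => ?_)
  have : (0 : ℝ) ≤ m := m.cast_nonneg
  linarith

theorem log_Gamma_add_one {x : ℝ} (hx : 0 < x) :
    Real.log (Real.Gamma (x + 1)) = Real.log x + Real.log (Real.Gamma x) := by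
  rw [Real.Gamma_add_one hx.ne', Real.log_mul hx.ne' (Real.Gamma_pos_of_pos hx).ne']

theorem digamma_add_one {x : ℝ} (hx : 0 < x) : digamma (x + 1) = digamma x + x⁻¹ := by
  have h1 : HasDerivAt (fun y => Real.log (Real.Gamma (y + 1))) (digamma (x + 1)) x :=
    (differentiableAt_log_Gamma (by linarith : 0 < x + 1)).hasDerivAt.comp_add_const x 1
  have h2 : HasDerivAt (fun y => Real.log y + Real.log (Real.Gamma y)) (x⁻¹ + digamma x) x :=
    (Real.hasDerivAt_log hx.ne').add (differentiableAt_log_Gamma hx).hasDerivAt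
  rw [add_comm (digamma x)]
  refine h1.unique (h2.congr_of_eventuallyEq ?_)
  filter_upwards [Ioi_mem_nhds hx] with y hy using log_Gamma_add_one hy

theorem digamma_le_log {x : ℝ} (hx : 0 < x) : digamma x ≤ Real.log x := by
  have h := Real.convexOn_log_Gamma.deriv_le_slope (mem_Ioi.2 hx)
    (mem_Ioi.2 (by linarith : 0 < x + 1)) (by linarith) (differentiableAt_log_Gamma hx)
  rw [slope_def_field, Function.comp_apply, Function.comp_apply, log_Gamma_add_one hx] at h
  change deriv (Real.log ∘ Real.Gamma) x ≤ Real.log x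
  simpa using h

theorem log_sub_one_le_digamma {x : ℝ} (hx : 1 < x) : Real.log (x - 1) ≤ digamma x := by
  have hx' : 0 < x - 1 := by linarith
  have h := Real.convexOn_log_Gamma.slope_le_deriv (mem_Ioi.2 hx')
    (mem_Ioi.2 (by linarith : 0 < x)) (by linarith) (differentiableAt_log_Gamma (by linarith))
  have hG := log_Gamma_add_one hx'
  rw [sub_add_cancel] at hG
  rw [slope_def_field, Function.comp_apply, Function.comp_apply, hG] at h
  change Real.log (x - 1) ≤ deriv (Real.log ∘ Real.Gamma) x
  simpa using h

theorem tendsto_digamma_sub_log :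
    Tendsto (fun x => digamma x - Real.log (x - 1 / 2)) atTop (𝓝 0) := by
  have hlim : Tendsto (fun x : ℝ => (x - 1)⁻¹) atTop (𝓝 0) :=
    tendsto_inv_atTop_zero.comp (tendsto_atTop_add_const_right _ (-1) tendsto_id)
  have hbound : ∀ a b : ℝ, 0 < a → a ≤ b → b ≤ a + 1 → Real.log b - Real.log a ≤ a⁻¹ := by
    intro a b ha hab hba
    rw [← Real.log_div (by linarith) ha.ne']
    refine (Real.log_le_sub_one_of_pos (div_pos (by linarith) ha)).trans ?_
    rw [div_sub_one ha.ne', inv_eq_one_div]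
    gcongr
    linarith
  refine tendsto_of_tendsto_of_tendsto_of_le_of_le' (by simpa using hlim.neg) hlim ?_ ?_
  · filter_upwards [eventually_gt_atTop 1] with x hx
    have h1 := log_sub_one_le_digamma hx
    have h2 := hbound (x - 1) (x - 1 / 2) (by linarith) (by linarith) (by linarith)
    linarith
  · filter_upwards [eventually_gt_atTop 1] with x hx
    have h1 := digamma_le_log (by linarith : 0 < x)
    have h2 := hbound (x - 1) x (by linarith) (by linarith) (by linarith)
    have h3 : Real.log (x - 1) ≤ Real.log (x - 1 / 2) :=
      Real.log_le_log (by linarith) (by linarith)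
    linarith

theorem digamma_sub_digammaApprox (n : ℕ) {x : ℝ} (hx : 0 < x) :
    digamma x - digammaApprox n x = digamma (x + n) - Real.log (x + n - 1 / 2) := by
  induction n generalizing x with
  | zero => simp [digammaApprox]
  | succ n ih =>
    have h := ih (x := x + 1) (by linarith)
    have h1 := digamma_add_one hx
    have h2 : x + ((n + 1 : ℕ) : ℝ) = x + 1 + n := by push_cast; ring
    rw [h2, ← h, h1]
    simp only [digammaApprox]
    ring

theorem tendsto_digammaApprox {x : ℝ} (hx : 0 < x) :
    Tendsto (fun n => digammaApprox n x) atTop (𝓝 (digamma x)) := by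
  have h := tendsto_digamma_sub_log.comp
    (tendsto_atTop_add_const_left atTop x tendsto_natCast_atTop_atTop)
  have h' := h.const_sub (digamma x)
  rw [sub_zero] at h'
  refine h'.congr fun n => ?_
  simp only [Function.comp_apply]
  linarith [digamma_sub_digammaApprox n hx]

theorem convexOn_exp_digamma : ConvexOn ℝ (Ioi 0) (fun x => Real.exp (digamma x)) := by
  have hlim : ∀ x : ℝ, 0 < x → Tendsto (fun n => Real.exp (digammaApprox (n + 1) x)) atTop
      (𝓝 (Real.exp (digamma x))) := fun x hx =>
    (Real.continuous_exp.tendsto _).comp ((tendsto_add_atTop_iff_nat 1).2 (tendsto_digammaApprox hx))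
  refine ⟨convex_Ioi 0, fun x hx y hy a b ha hb hab => ?_⟩
  exact le_of_tendsto_of_tendsto' (hlim _ (convex_Ioi 0 hx hy ha hb hab))
    (((hlim x hx).const_smul a).add ((hlim y hy).const_smul b))
    fun n => (convexOn_exp_digammaApprox n).2 hx hy ha hb hab

theorem ConvexOn.antitoneOn_Ioi_of_le {f : ℝ → ℝ} {a C : ℝ} (hf : ConvexOn ℝ (Ioi a) f)
    (hC : ∀ x ∈ Ioi a, f x ≤ C) : AntitoneOn f (Ioi a) := by
  intro x hx y hy hxy
  by_contra! hlt
  have hxy' : x < y := hxy.lt_of_ne fun h => by simp [h] at hlt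
  set m := (f y - f x) / (y - x) with hm
  have hmpos : 0 < m := div_pos (by linarith) (by linarith)
  have hCy := hC y hy
  have hd : 0 < (C - f y + 1) / m := div_pos (by linarith) hmpos
  have hz : y + (C - f y + 1) / m ∈ Ioi a := mem_Ioi.2 (by linarith [mem_Ioi.1 hy])
  have h := hf.slope_mono_adjacent hx hz hxy' (by linarith)
  rw [← hm, add_sub_cancel_left, le_div_iff₀ hd, mul_div_cancel₀ _ hmpos.ne'] at h
  linarith [hC _ hz]

/-- For every real `s`, the function `z_{s,s}(x) = e^{ψ(x+s)} − x` is convex and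
decreasing on `(−s, ∞)`. -/
theorem z_diag_convex_and_decreasing (s : ℝ) :
    ConvexOn ℝ (Set.Ioi (-s)) (fun x : ℝ => Real.exp (digamma (x + s)) - x) ∧
      AntitoneOn (fun x : ℝ => Real.exp (digamma (x + s)) - x) (Set.Ioi (-s)) := by
  have hpre : (fun z => s + z) ⁻¹' Ioi 0 = Ioi (-s) := by
    ext z
    simp [neg_lt_iff_pos_add']
  have hconv : ConvexOn ℝ (Ioi (-s)) (fun x : ℝ => Real.exp (digamma (x + s)) - x) := by
    have h := convexOn_exp_digamma.translate_left s
    rw [hpre] at h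
    exact h.sub (concaveOn_id (convex_Ioi _))
  refine ⟨hconv, hconv.antitoneOn_Ioi_of_le (C := s) fun x hx => ?_⟩
  have hpos : 0 < x + s := by linarith [mem_Ioi.1 hx]
  have h := Real.exp_le_exp.2 (digamma_le_log hpos)
  rw [Real.exp_log hpos] at h
  linarith
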